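/- arXiv:2303.01474 — 2 statements merged into one kernel-verified Lean document; each statement's English description precedes it below -/
import Mathlib

section
/- Assume f, g are twice continuously differentiable, −f(x,·) and g_i(x,·) are convex on ℝᵐ for all x ∈ X, and X = {x ∈ ℝⁿ : h(x) ≤ 0} with h : ℝⁿ → ℝ^r continuously differentiable. Let (x̄,ȳ) be a local solution of the minimax problem min_{x∈X} max_{y∈F(x)} f(x,y) in the sense of Stackelberg and let λ̄ ∈ Σ(x̄,ȳ). If MPEC-LICQ holds at (x̄,ȳ,λ̄), i.e., the gradients with respect to (x,y,λ) of the active constraints of the system h(x) ≤ 0, ∇_y L(x,y,λ) = 0, g_i(x,y) = 0 for i ∈ I_{0+} ∪ I_{00}, λ_i = 0 for i ∈ I_{+0} ∪ I_{00} are linearly independent at (x̄,ȳ,λ̄), then (x̄,ȳ,λ̄) is an S-stationary point of (P_MPEC). -/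
open Filter Topology Metric RealInnerProductSpace

noncomputable section

/-- Feasible region of the parametric maximization problem. -/
def Feas {n m q : ℕ} (g : EuclideanSpace ℝ (Fin n) → EuclideanSpace ℝ (Fin m) → Fin q → ℝ)
    (x : EuclideanSpace ℝ (Fin n)) : Set (EuclideanSpace ℝ (Fin m)) :=
  {y | ∀ i, g x y i ≤ 0}

/-- Maximal value function (EReal valued; `sSup ∅ = ⊥ = -∞`). -/
def Vfun {n m q : ℕ} (f : EuclideanSpace ℝ (Fin n) → EuclideanSpace ℝ (Fin m) → ℝ)
    (g : EuclideanSpace ℝ (Fin n) → EuclideanSpace ℝ (Fin m) → Fin q → ℝ)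
    (x : EuclideanSpace ℝ (Fin n)) : EReal :=
  sSup ((fun y => (f x y : EReal)) '' Feas g x)

/-- Solution map of the parametric maximization problem. -/
def Sol {n m q : ℕ} (f : EuclideanSpace ℝ (Fin n) → EuclideanSpace ℝ (Fin m) → ℝ)
    (g : EuclideanSpace ℝ (Fin n) → EuclideanSpace ℝ (Fin m) → Fin q → ℝ)
    (x : EuclideanSpace ℝ (Fin n)) : Set (EuclideanSpace ℝ (Fin m)) :=
  {y ∈ Feas g x | (f x y : EReal) = Vfun f g x}

/-- Lagrangian `L(x,y,λ) = f(x,y) - λᵀ g(x,y)`. -/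
def Lag {n m q : ℕ} (f : EuclideanSpace ℝ (Fin n) → EuclideanSpace ℝ (Fin m) → ℝ)
    (g : EuclideanSpace ℝ (Fin n) → EuclideanSpace ℝ (Fin m) → Fin q → ℝ)
    (x : EuclideanSpace ℝ (Fin n)) (y : EuclideanSpace ℝ (Fin m)) (lam : Fin q → ℝ) : ℝ :=
  f x y - ∑ i, lam i * g x y i

/-- Partial gradient in `x`. -/
def gradx {n m : ℕ} (φ : EuclideanSpace ℝ (Fin n) → EuclideanSpace ℝ (Fin m) → ℝ)
    (x : EuclideanSpace ℝ (Fin n)) (y : EuclideanSpace ℝ (Fin m)) : EuclideanSpace ℝ (Fin n) :=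
  gradient (fun x' => φ x' y) x

/-- Partial gradient in `y`. -/
def grady {n m : ℕ} (φ : EuclideanSpace ℝ (Fin n) → EuclideanSpace ℝ (Fin m) → ℝ)
    (x : EuclideanSpace ℝ (Fin n)) (y : EuclideanSpace ℝ (Fin m)) : EuclideanSpace ℝ (Fin m) :=
  gradient (fun y' => φ x y') y

/-- `∇_y L(x,y,λ)`. -/
def gradyL {n m q : ℕ} (f : EuclideanSpace ℝ (Fin n) → EuclideanSpace ℝ (Fin m) → ℝ)
    (g : EuclideanSpace ℝ (Fin n) → EuclideanSpace ℝ (Fin m) → Fin q → ℝ)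
    (x : EuclideanSpace ℝ (Fin n)) (y : EuclideanSpace ℝ (Fin m)) (lam : Fin q → ℝ) :
    EuclideanSpace ℝ (Fin m) :=
  grady (fun x y => Lag f g x y lam) x y

/-- `∇_x L(x,y,λ)`. -/
def gradxL {n m q : ℕ} (f : EuclideanSpace ℝ (Fin n) → EuclideanSpace ℝ (Fin m) → ℝ)
    (g : EuclideanSpace ℝ (Fin n) → EuclideanSpace ℝ (Fin m) → Fin q → ℝ)
    (x : EuclideanSpace ℝ (Fin n)) (y : EuclideanSpace ℝ (Fin m)) (lam : Fin q → ℝ) :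
    EuclideanSpace ℝ (Fin n) :=
  gradx (fun x y => Lag f g x y lam) x y

/-- `∇_y g(x,y)ᵀ u ∈ ℝ^q`. -/
def gyTu {n m q : ℕ} (g : EuclideanSpace ℝ (Fin n) → EuclideanSpace ℝ (Fin m) → Fin q → ℝ)
    (x : EuclideanSpace ℝ (Fin n)) (y : EuclideanSpace ℝ (Fin m)) (u : EuclideanSpace ℝ (Fin m)) :
    Fin q → ℝ :=
  fun i => ⟪grady (fun x y => g x y i) x y, u⟫

/-- `∇²_{yy} L(x,y,λ) u`. -/
def hessyyLu {n m q : ℕ} (f : EuclideanSpace ℝ (Fin n) → EuclideanSpace ℝ (Fin m) → ℝ)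
    (g : EuclideanSpace ℝ (Fin n) → EuclideanSpace ℝ (Fin m) → Fin q → ℝ)
    (x : EuclideanSpace ℝ (Fin n)) (y : EuclideanSpace ℝ (Fin m)) (lam : Fin q → ℝ)
    (u : EuclideanSpace ℝ (Fin m)) : EuclideanSpace ℝ (Fin m) :=
  gradient (fun y' => ⟪gradyL f g x y' lam, u⟫) y

/-- `∇²_{xy} L(x,y,λ) u ∈ ℝⁿ` (for `u ∈ ℝᵐ`). -/
def hessxyLu {n m q : ℕ} (f : EuclideanSpace ℝ (Fin n) → EuclideanSpace ℝ (Fin m) → ℝ)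
    (g : EuclideanSpace ℝ (Fin n) → EuclideanSpace ℝ (Fin m) → Fin q → ℝ)
    (x : EuclideanSpace ℝ (Fin n)) (y : EuclideanSpace ℝ (Fin m)) (lam : Fin q → ℝ)
    (u : EuclideanSpace ℝ (Fin m)) : EuclideanSpace ℝ (Fin n) :=
  gradient (fun x' => ⟪gradyL f g x' y lam, u⟫) x

/-- Multiplier set `Σ(x,y)`. -/
def SigmaSet {n m q : ℕ} (f : EuclideanSpace ℝ (Fin n) → EuclideanSpace ℝ (Fin m) → ℝ)
    (g : EuclideanSpace ℝ (Fin n) → EuclideanSpace ℝ (Fin m) → Fin q → ℝ)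
    (x : EuclideanSpace ℝ (Fin n)) (y : EuclideanSpace ℝ (Fin m)) : Set (Fin q → ℝ) :=
  {lam | gradyL f g x y lam = 0 ∧ (∀ i, 0 ≤ lam i) ∧ (∀ i, g x y i ≤ 0) ∧
    ∑ i, lam i * g x y i = 0}

/-- Singular multiplier set `Σ⁰(x,y)`. -/
def SigmaZero {n m q : ℕ} (g : EuclideanSpace ℝ (Fin n) → EuclideanSpace ℝ (Fin m) → Fin q → ℝ)
    (x : EuclideanSpace ℝ (Fin n)) (y : EuclideanSpace ℝ (Fin m)) : Set (Fin q → ℝ) :=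
  {lam | ∑ i, lam i • grady (fun x y => g x y i) x y = 0 ∧ (∀ i, 0 ≤ lam i) ∧
    (∀ i, g x y i ≤ 0) ∧ ∑ i, lam i * g x y i = 0}

/-- The set `Ξ^r(x,y,λ)`. -/
def XiSet {n m q : ℕ} (r : ℝ) (f : EuclideanSpace ℝ (Fin n) → EuclideanSpace ℝ (Fin m) → ℝ)
    (g : EuclideanSpace ℝ (Fin n) → EuclideanSpace ℝ (Fin m) → Fin q → ℝ)
    (x : EuclideanSpace ℝ (Fin n)) (y : EuclideanSpace ℝ (Fin m)) (lam : Fin q → ℝ) :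
    Set (EuclideanSpace ℝ (Fin m)) :=
  {u | hessyyLu f g x y lam u = 0 ∧ (∀ i, 0 ≤ -(gyTu g x y u i) - r * g x y i) ∧
    (∀ i, 0 ≤ lam i) ∧ ∑ i, lam i * (-(gyTu g x y u i) - r * g x y i) = 0}

/-- Fréchet (regular) subdifferential of an `EReal` valued function. -/
def FSub {n : ℕ} (φ : EuclideanSpace ℝ (Fin n) → EReal) (x₀ : EuclideanSpace ℝ (Fin n)) :
    Set (EuclideanSpace ℝ (Fin n)) :=
  {v | ∃ c : ℝ, φ x₀ = (c : EReal) ∧ ∀ ε : ℝ, 0 < ε → ∃ δ : ℝ, 0 < δ ∧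
    ∀ x, ‖x - x₀‖ < δ → ((c + ⟪v, x - x₀⟫ - ε * ‖x - x₀‖ : ℝ) : EReal) ≤ φ x}

/-- Limiting (Mordukhovich) subdifferential. -/
def LSub {n : ℕ} (φ : EuclideanSpace ℝ (Fin n) → EReal) (x₀ : EuclideanSpace ℝ (Fin n)) :
    Set (EuclideanSpace ℝ (Fin n)) :=
  {v | ∃ (xk : ℕ → EuclideanSpace ℝ (Fin n)) (vk : ℕ → EuclideanSpace ℝ (Fin n)),
    (∀ k, vk k ∈ FSub φ (xk k)) ∧ Tendsto xk atTop (𝓝 x₀) ∧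
    Tendsto (fun k => φ (xk k)) atTop (𝓝 (φ x₀)) ∧ Tendsto vk atTop (𝓝 v)}

/-- Horizon (singular) subdifferential. -/
def HorSub {n : ℕ} (φ : EuclideanSpace ℝ (Fin n) → EReal) (x₀ : EuclideanSpace ℝ (Fin n)) :
    Set (EuclideanSpace ℝ (Fin n)) :=
  {v | ∃ (xk : ℕ → EuclideanSpace ℝ (Fin n)) (vk : ℕ → EuclideanSpace ℝ (Fin n)) (tk : ℕ → ℝ),
    (∀ k, vk k ∈ FSub φ (xk k)) ∧ (∀ k, 0 < tk k) ∧ Tendsto tk atTop (𝓝 0) ∧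
    Tendsto xk atTop (𝓝 x₀) ∧ Tendsto (fun k => φ (xk k)) atTop (𝓝 (φ x₀)) ∧
    Tendsto (fun k => tk k • vk k) atTop (𝓝 v)}

/-- Clarke subdifferential (for locally Lipschitz functions): convex hull of the limiting one. -/
def CSub {n : ℕ} (φ : EuclideanSpace ℝ (Fin n) → EReal) (x₀ : EuclideanSpace ℝ (Fin n)) :
    Set (EuclideanSpace ℝ (Fin n)) :=
  convexHull ℝ (LSub φ x₀)

/-- `φ` is (finite-valued and) Lipschitz continuous near `x₀`. -/
def LipschitzNearAt {n : ℕ} (φ : EuclideanSpace ℝ (Fin n) → EReal)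
    (x₀ : EuclideanSpace ℝ (Fin n)) : Prop :=
  ∃ δ : ℝ, 0 < δ ∧ ∃ K : NNReal, ∃ ψ : EuclideanSpace ℝ (Fin n) → ℝ,
    LipschitzWith K ψ ∧ ∀ x ∈ ball x₀ δ, φ x = (ψ x : EReal)

/-- Regular (Fréchet) normal cone. -/
def regNC {n : ℕ} (C : Set (EuclideanSpace ℝ (Fin n))) (x₀ : EuclideanSpace ℝ (Fin n)) :
    Set (EuclideanSpace ℝ (Fin n)) :=
  {ξ | ∀ ε : ℝ, 0 < ε → ∃ δ : ℝ, 0 < δ ∧ ∀ x ∈ C, ‖x - x₀‖ < δ →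
    ⟪ξ, x - x₀⟫ ≤ ε * ‖x - x₀‖}

/-- Limiting (Mordukhovich) normal cone. -/
def limNC {n : ℕ} (C : Set (EuclideanSpace ℝ (Fin n))) (x₀ : EuclideanSpace ℝ (Fin n)) :
    Set (EuclideanSpace ℝ (Fin n)) :=
  {ξ | ∃ (xk : ℕ → EuclideanSpace ℝ (Fin n)) (ξk : ℕ → EuclideanSpace ℝ (Fin n)),
    (∀ k, xk k ∈ C) ∧ (∀ k, ξk k ∈ regNC C (xk k)) ∧
    Tendsto xk atTop (𝓝 x₀) ∧ Tendsto ξk atTop (𝓝 ξ)}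

/-- Inner semicontinuity of the solution map at `(x̄, ȳ)`. -/
def InnerSemicont {n m q : ℕ} (f : EuclideanSpace ℝ (Fin n) → EuclideanSpace ℝ (Fin m) → ℝ)
    (g : EuclideanSpace ℝ (Fin n) → EuclideanSpace ℝ (Fin m) → Fin q → ℝ)
    (xb : EuclideanSpace ℝ (Fin n)) (yb : EuclideanSpace ℝ (Fin m)) : Prop :=
  ∀ xk : ℕ → EuclideanSpace ℝ (Fin n), Tendsto xk atTop (𝓝 xb) →
    ∃ yk : ℕ → EuclideanSpace ℝ (Fin m), (∀ k, yk k ∈ Sol f g (xk k)) ∧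
      Tendsto yk atTop (𝓝 yb)

/-- Local error bound for the system `g(x,y) ≤ 0` at `(x̄, ȳ)`. -/
def LocalErrorBound {n m q : ℕ}
    (g : EuclideanSpace ℝ (Fin n) → EuclideanSpace ℝ (Fin m) → Fin q → ℝ)
    (xb : EuclideanSpace ℝ (Fin n)) (yb : EuclideanSpace ℝ (Fin m)) : Prop :=
  ∃ κ δ : ℝ, 0 < κ ∧ 0 < δ ∧
    ∀ x y, ‖((x, y) : EuclideanSpace ℝ (Fin n) × EuclideanSpace ℝ (Fin m)) - (xb, yb)‖ < δ →
      Metric.infDist ((x, y) : EuclideanSpace ℝ (Fin n) × EuclideanSpace ℝ (Fin m))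
          {p : EuclideanSpace ℝ (Fin n) × EuclideanSpace ℝ (Fin m) | ∀ i, g p.1 p.2 i ≤ 0}
        ≤ κ * ∑ i, max (g x y i) 0

/-- MFCQ for the system `g(x̄, ·) ≤ 0` at `ȳ`. -/
def MFCQy {n m q : ℕ} (g : EuclideanSpace ℝ (Fin n) → EuclideanSpace ℝ (Fin m) → Fin q → ℝ)
    (xb : EuclideanSpace ℝ (Fin n)) (yb : EuclideanSpace ℝ (Fin m)) : Prop :=
  ∀ lam : Fin q → ℝ, (∀ i, 0 ≤ lam i) → (∑ i, lam i * g xb yb i = 0) →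
    (∀ i, g xb yb i ≤ 0) → (∑ i, lam i • grady (fun x y => g x y i) xb yb = 0) → lam = 0

/-- Restricted sup-compactness at `x̄`. -/
def RestrictedSupCompact {n m q : ℕ}
    (f : EuclideanSpace ℝ (Fin n) → EuclideanSpace ℝ (Fin m) → ℝ)
    (g : EuclideanSpace ℝ (Fin n) → EuclideanSpace ℝ (Fin m) → Fin q → ℝ)
    (xb : EuclideanSpace ℝ (Fin n)) : Prop :=
  (∃ c : ℝ, Vfun f g xb = (c : EReal)) ∧
  ∃ ε δ : ℝ, 0 < ε ∧ 0 < δ ∧ ∃ Ω : Set (EuclideanSpace ℝ (Fin m)), IsCompact Ω ∧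
    ∀ x, ‖x - xb‖ < δ → Vfun f g xb - (ε : EReal) < Vfun f g x → (Sol f g x ∩ Ω).Nonempty

/-- Robinson stability of the feasible map at `(x̄, ȳ)`. -/
def RobinsonStability {n m q : ℕ}
    (g : EuclideanSpace ℝ (Fin n) → EuclideanSpace ℝ (Fin m) → Fin q → ℝ)
    (xb : EuclideanSpace ℝ (Fin n)) (yb : EuclideanSpace ℝ (Fin m)) : Prop :=
  ∃ κ δ : ℝ, 0 < κ ∧ 0 < δ ∧
    ∀ x y, ‖((x, y) : EuclideanSpace ℝ (Fin n) × EuclideanSpace ℝ (Fin m)) - (xb, yb)‖ < δ →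
      Metric.infDist y (Feas g x) ≤ κ * ∑ i, max (g x y i) 0

/-- A constraint qualification holds at the feasible point `w₀` of the system
`{w : G w ≤ 0, H w = 0}`: local minimizers of C¹ functions over the feasible set
satisfy the KKT conditions. -/
def CQAt {W : Type} [NormedAddCommGroup W] [NormedSpace ℝ W] {p p' : ℕ}
    (G : W → Fin p → ℝ) (H : W → Fin p' → ℝ) (w₀ : W) : Prop :=
  ∀ θ : W → ℝ, ContDiff ℝ 1 θ →
    IsLocalMinOn θ {w | (∀ i, G w i ≤ 0) ∧ ∀ j, H w j = 0} w₀ →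
    ∃ (lam : Fin p → ℝ) (mu : Fin p' → ℝ), (∀ i, 0 ≤ lam i) ∧
      (fderiv ℝ θ w₀ + ∑ i, lam i • fderiv ℝ (fun w => G w i) w₀ +
        ∑ j, mu j • fderiv ℝ (fun w => H w j) w₀ = 0) ∧
      ∑ i, lam i * G w₀ i = 0

/-- Inequality constraints of the Wolfe dual system (`λ ≥ 0`). -/
def WolfeG (n m q : ℕ) :
    (EuclideanSpace ℝ (Fin n) × EuclideanSpace ℝ (Fin m) × (Fin q → ℝ)) → Fin q → ℝ :=
  fun w i => -(w.2.2 i)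

/-- Equality constraints of the Wolfe dual system (`∇_y L(x,y,λ) = 0`). -/
def WolfeH {n m q : ℕ} (f : EuclideanSpace ℝ (Fin n) → EuclideanSpace ℝ (Fin m) → ℝ)
    (g : EuclideanSpace ℝ (Fin n) → EuclideanSpace ℝ (Fin m) → Fin q → ℝ) :
    (EuclideanSpace ℝ (Fin n) × EuclideanSpace ℝ (Fin m) × (Fin q → ℝ)) → Fin m → ℝ :=
  fun w j => gradyL f g w.1 w.2.1 w.2.2 j

/-- The multiplier set `M(β, x, y)` of the parametric program. -/
def MultSetP {n m q : ℕ} (g : EuclideanSpace ℝ (Fin n) → EuclideanSpace ℝ (Fin m) → Fin q → ℝ)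
    (β : EuclideanSpace ℝ (Fin m)) (x : EuclideanSpace ℝ (Fin n))
    (y : EuclideanSpace ℝ (Fin m)) : Set (Fin q → ℝ) :=
  {lam | β - ∑ i, lam i • grady (fun x y => g x y i) x y = 0 ∧ (∀ i, 0 ≤ lam i) ∧
    ∑ i, lam i * g x y i = 0 ∧ ∀ i, g x y i ≤ 0}

/-- A stable parametric CQ holds at `ȳ ∈ F(x̄)` for the parametric system `g(x,·) ≤ 0`. -/
def StableParamCQ {n m q : ℕ} (f : EuclideanSpace ℝ (Fin n) → EuclideanSpace ℝ (Fin m) → ℝ)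
    (g : EuclideanSpace ℝ (Fin n) → EuclideanSpace ℝ (Fin m) → Fin q → ℝ)
    (xb : EuclideanSpace ℝ (Fin n)) (yb : EuclideanSpace ℝ (Fin m)) : Prop :=
  ∃ P : EuclideanSpace ℝ (Fin n) → EuclideanSpace ℝ (Fin m) → Prop,
    (∃ δ : ℝ, 0 < δ ∧ ∀ x y, y ∈ Feas g x → ‖x - xb‖ < δ → ‖y - yb‖ < δ → P x y) ∧
    (∀ x y, P x y → y ∈ Feas g x → IsLocalMaxOn (f x) (Feas g x) y →
      (MultSetP g (grady f x y) x y).Nonempty) ∧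
    (∀ (βk : ℕ → EuclideanSpace ℝ (Fin m)) (xk : ℕ → EuclideanSpace ℝ (Fin n))
        (yk : ℕ → EuclideanSpace ℝ (Fin m)) (βb : EuclideanSpace ℝ (Fin m)),
      Tendsto βk atTop (𝓝 βb) → Tendsto xk atTop (𝓝 xb) → Tendsto yk atTop (𝓝 yb) →
      (∀ k, (MultSetP g (βk k) (xk k) (yk k)).Nonempty) →
      ∃ (lamk : ℕ → Fin q → ℝ) (φ : ℕ → ℕ) (lamb : Fin q → ℝ),
        StrictMono φ ∧ (∀ k, lamk k ∈ MultSetP g (βk k) (xk k) (yk k)) ∧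
        Tendsto (lamk ∘ φ) atTop (𝓝 lamb) ∧ lamb ∈ MultSetP g βb xb yb)

/-- The multiplier set `M(β, w)` of a (nonparametric) system `{w : G w ≤ 0, H w = 0}`. -/
def MultSetW {W : Type} [NormedAddCommGroup W] [NormedSpace ℝ W] {p p' : ℕ}
    (G : W → Fin p → ℝ) (H : W → Fin p' → ℝ) (β : W →L[ℝ] ℝ) (w : W) :
    Set ((Fin p → ℝ) × (Fin p' → ℝ)) :=
  {lm | (∀ i, 0 ≤ lm.1 i) ∧
    (β - ∑ i, lm.1 i • fderiv ℝ (fun w => G w i) w -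
      ∑ j, lm.2 j • fderiv ℝ (fun w => H w j) w = 0) ∧
    ∑ i, lm.1 i * G w i = 0}

/-- A stable CQ holds at the feasible point `w̄` of the system `{w : G w ≤ 0, H w = 0}`. -/
def StableCQ {W : Type} [NormedAddCommGroup W] [NormedSpace ℝ W] {p p' : ℕ}
    (G : W → Fin p → ℝ) (H : W → Fin p' → ℝ) (wb : W) : Prop :=
  ∃ P : W → Prop,
    (P wb ∧ ∃ δ : ℝ, 0 < δ ∧ ∀ w, (∀ i, G w i ≤ 0) → (∀ j, H w j = 0) → ‖w - wb‖ < δ → P w) ∧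
    (∀ w, P w → (∀ i, G w i ≤ 0) → (∀ j, H w j = 0) →
      ∀ θ : W → ℝ, ContDiff ℝ 1 θ →
        IsLocalMinOn θ {w' | (∀ i, G w' i ≤ 0) ∧ ∀ j, H w' j = 0} w →
        ∃ (lam : Fin p → ℝ) (mu : Fin p' → ℝ), (∀ i, 0 ≤ lam i) ∧
          (fderiv ℝ θ w + ∑ i, lam i • fderiv ℝ (fun w => G w i) w +
            ∑ j, mu j • fderiv ℝ (fun w => H w j) w = 0) ∧
          ∑ i, lam i * G w i = 0) ∧
    (∀ (βk : ℕ → W →L[ℝ] ℝ) (wk : ℕ → W) (βb : W →L[ℝ] ℝ),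
      Tendsto βk atTop (𝓝 βb) → Tendsto wk atTop (𝓝 wb) →
      (∀ k, (∀ i, G (wk k) i ≤ 0) ∧ ∀ j, H (wk k) j = 0) →
      (∀ k, (MultSetW G H (βk k) (wk k)).Nonempty) →
      ∃ (lmk : ℕ → (Fin p → ℝ) × (Fin p' → ℝ)) (φ : ℕ → ℕ) (lmb : (Fin p → ℝ) × (Fin p' → ℝ)),
        StrictMono φ ∧ (∀ k, lmk k ∈ MultSetW G H (βk k) (wk k)) ∧
        Tendsto (lmk ∘ φ) atTop (𝓝 lmb) ∧ lmb ∈ MultSetW G H βb wb)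

/-- Critical cone of `(P_x̄)` at `y` associated with the multiplier `λ`. -/
def CritCone {n m q : ℕ} (g : EuclideanSpace ℝ (Fin n) → EuclideanSpace ℝ (Fin m) → Fin q → ℝ)
    (xb : EuclideanSpace ℝ (Fin n)) (y : EuclideanSpace ℝ (Fin m)) (lam : Fin q → ℝ) :
    Set (EuclideanSpace ℝ (Fin m)) :=
  {d | ∀ i, g xb y i = 0 →
    (0 < lam i → ⟪grady (fun x y => g x y i) xb y, d⟫ = 0) ∧
    (lam i = 0 → ⟪grady (fun x y => g x y i) xb y, d⟫ ≤ 0)}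

/-- Second order sufficient condition at `(y, λ)` for `(P_x̄)`. -/
def SOSC {n m q : ℕ} (f : EuclideanSpace ℝ (Fin n) → EuclideanSpace ℝ (Fin m) → ℝ)
    (g : EuclideanSpace ℝ (Fin n) → EuclideanSpace ℝ (Fin m) → Fin q → ℝ)
    (xb : EuclideanSpace ℝ (Fin n)) (y : EuclideanSpace ℝ (Fin m)) (lam : Fin q → ℝ) : Prop :=
  ∀ d ∈ CritCone g xb y lam, d ≠ 0 → ⟪d, hessyyLu f g xb y lam d⟫ < 0

/-- `(x̄, ȳ)` is a local solution of the minimax problem in the sense of Stackelberg. -/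
def StackelbergLocal {n m q : ℕ} (f : EuclideanSpace ℝ (Fin n) → EuclideanSpace ℝ (Fin m) → ℝ)
    (g : EuclideanSpace ℝ (Fin n) → EuclideanSpace ℝ (Fin m) → Fin q → ℝ)
    (X : Set (EuclideanSpace ℝ (Fin n))) (xb : EuclideanSpace ℝ (Fin n))
    (yb : EuclideanSpace ℝ (Fin m)) : Prop :=
  xb ∈ X ∧ yb ∈ Sol f g xb ∧ IsLocalMinOn (Vfun f g) X xb

/-- Feasible region of the MPEC reformulation `(P_MPEC)`. -/
def MPECFeas {n m q : ℕ} (f : EuclideanSpace ℝ (Fin n) → EuclideanSpace ℝ (Fin m) → ℝ)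
    (g : EuclideanSpace ℝ (Fin n) → EuclideanSpace ℝ (Fin m) → Fin q → ℝ)
    (X : Set (EuclideanSpace ℝ (Fin n))) :
    Set (EuclideanSpace ℝ (Fin n) × EuclideanSpace ℝ (Fin m) × (Fin q → ℝ)) :=
  {w | w.1 ∈ X ∧ gradyL f g w.1 w.2.1 w.2.2 = 0 ∧ (∀ i, g w.1 w.2.1 i ≤ 0) ∧
    (∀ i, 0 ≤ w.2.2 i) ∧ ∑ i, w.2.2 i * g w.1 w.2.1 i = 0}

/-- S-stationarity for `(P_MPEC)`. -/
def SStationary {n m q : ℕ} (f : EuclideanSpace ℝ (Fin n) → EuclideanSpace ℝ (Fin m) → ℝ)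
    (g : EuclideanSpace ℝ (Fin n) → EuclideanSpace ℝ (Fin m) → Fin q → ℝ)
    (X : Set (EuclideanSpace ℝ (Fin n))) (xb : EuclideanSpace ℝ (Fin n))
    (yb : EuclideanSpace ℝ (Fin m)) (lamb : Fin q → ℝ) : Prop :=
  ∃ (u : EuclideanSpace ℝ (Fin m)) (α β : Fin q → ℝ),
    -(gradx f xb yb + ∑ i, α i • gradx (fun x y => g x y i) xb yb +
        hessxyLu f g xb yb lamb u) ∈ limNC X xb ∧
    grady f xb yb + ∑ i, α i • grady (fun x y => g x y i) xb yb +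
      hessyyLu f g xb yb lamb u = 0 ∧
    (∀ i, -(gyTu g xb yb u i) - β i = 0) ∧
    (∀ i, g xb yb i < 0 → lamb i = 0 → α i = 0) ∧
    (∀ i, g xb yb i = 0 → 0 < lamb i → β i = 0) ∧
    (∀ i, g xb yb i = 0 → lamb i = 0 → 0 ≤ α i ∧ 0 ≤ β i)


/-- Optimal value function of the Wolfe dual (`sInf ∅ = ⊤`). -/
def VD {n m q : ℕ} (f : EuclideanSpace ℝ (Fin n) → EuclideanSpace ℝ (Fin m) → ℝ)
    (g : EuclideanSpace ℝ (Fin n) → EuclideanSpace ℝ (Fin m) → Fin q → ℝ)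
    (x : EuclideanSpace ℝ (Fin n)) : EReal :=
  sInf ((fun p : EuclideanSpace ℝ (Fin m) × (Fin q → ℝ) => (Lag f g x p.1 p.2 : EReal)) ''
    {p | gradyL f g x p.1 p.2 = 0 ∧ ∀ i, 0 ≤ p.2 i})

/-- Strict differentiability of an `EReal`-valued function at `x₀` with gradient `ζ`. -/
def StrictDiffAt {n : ℕ} (φ : EuclideanSpace ℝ (Fin n) → EReal)
    (x₀ ζ : EuclideanSpace ℝ (Fin n)) : Prop :=
  ∀ ε : ℝ, 0 < ε → ∃ δ : ℝ, 0 < δ ∧ ∀ x x', ‖x - x₀‖ < δ → ‖x' - x₀‖ < δ →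
    ∃ a b : ℝ, φ x = (a : EReal) ∧ φ x' = (b : EReal) ∧
      |a - b - ⟪ζ, x - x'⟫| ≤ ε * ‖x - x'‖

/-- `f` and `g` are separable with respect to `x` and `y`. -/
def SeparableFG {n m q : ℕ} (f : EuclideanSpace ℝ (Fin n) → EuclideanSpace ℝ (Fin m) → ℝ)
    (g : EuclideanSpace ℝ (Fin n) → EuclideanSpace ℝ (Fin m) → Fin q → ℝ) : Prop :=
  ∃ (f₁ : EuclideanSpace ℝ (Fin n) → ℝ) (f₂ : EuclideanSpace ℝ (Fin m) → ℝ)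
    (g₁ : EuclideanSpace ℝ (Fin n) → Fin q → ℝ) (g₂ : EuclideanSpace ℝ (Fin m) → Fin q → ℝ),
    (∀ x y, f x y = f₁ x + f₂ y) ∧ ∀ x y i, g x y i = g₁ x i + g₂ y i

end

section GeneralLemmas

variable {E : Type*} [NormedAddCommGroup E] [NormedSpace ℝ E]

/-- A linearly independent family of continuous linear functionals attains all value vectors. -/
theorem LinearIndependent.pi_surjective {ι : Type*} [Finite ι] {c' : ι → E →L[ℝ] ℝ}
    (hli : LinearIndependent ℝ c') :
    Function.Surjective (fun (v : E) (i : ι) => c' i v) := by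
  classical
  cases nonempty_fintype ι
  let T : E →ₗ[ℝ] (ι → ℝ) := LinearMap.pi fun i => (c' i : E →ₗ[ℝ] ℝ)
  change Function.Surjective T
  rw [← LinearMap.range_eq_top]
  by_contra hne
  obtain ⟨F, hF0, hF⟩ := Submodule.exists_le_ker_of_lt_top _ (lt_top_iff_ne_top.2 hne)
  have hFx (x : ι → ℝ) : F x = ∑ i, x i * F (Pi.single i 1) := by
    calc F x = F (∑ i, x i • Pi.single i 1) := by
          congr 1
          ext j
          simp [Finset.sum_apply, Pi.single_apply]
      _ = _ := by simp only [map_sum, map_smul, smul_eq_mul]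
  have hcoef : ∀ i, F (Pi.single i 1) = 0 := by
    refine Fintype.linearIndependent_iff.1 hli (fun i => F (Pi.single i 1)) ?_
    ext v
    have h0 : F (T v) = 0 := hF (LinearMap.mem_range_self T v)
    rw [hFx] at h0
    simpa [T, mul_comm] using h0
  exact hF0 (LinearMap.ext fun x => by simp [hFx x, hcoef])

theorem HasDerivAt.nonneg_of_eventually_ge_right {φ : ℝ → ℝ} {φ' : ℝ}
    (hφ : HasDerivAt φ φ' 0) (hmin : ∀ᶠ s in 𝓝[>] (0 : ℝ), φ 0 ≤ φ s) : 0 ≤ φ' := by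
  refine ge_of_tendsto hφ.tendsto_slope_zero_right ?_
  filter_upwards [hmin, self_mem_nhdsWithin] with s hs hs0
  rw [zero_add, smul_eq_mul]
  exact mul_nonneg (inv_nonneg.2 (le_of_lt hs0)) (sub_nonneg.2 hs)

/-- A critical point of a concave function is a global maximizer. -/
theorem ConcaveOn.le_of_hasFDerivAt_zero {φ : E → ℝ} (hφ : ConcaveOn ℝ Set.univ φ) {x : E}
    (hx : HasFDerivAt φ (0 : E →L[ℝ] ℝ) x) (y : E) : φ y ≤ φ x := by
  have hline : HasDerivAt (fun s : ℝ => x + s • (y - x)) (y - x) 0 := by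
    simpa using ((hasDerivAt_id (0 : ℝ)).smul_const (y - x)).const_add x
  have hx' : HasFDerivAt φ (0 : E →L[ℝ] ℝ) (x + (0 : ℝ) • (y - x)) := by simpa using hx
  have hd : HasDerivAt (fun s : ℝ => φ (x + s • (y - x)) - s * (φ y - φ x))
      (0 - (φ y - φ x)) 0 := by
    have h1 := hx'.comp_hasDerivAt (0 : ℝ) hline
    have h2 := (hasDerivAt_id (0 : ℝ)).mul_const (φ y - φ x)
    simpa using! h1.sub h2
  have := hd.nonneg_of_eventually_ge_right ?_
  · linarith
  · filter_upwards [Ioc_mem_nhdsGT (zero_lt_one' ℝ)] with s hs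
    have h := hφ.2 (Set.mem_univ x) (Set.mem_univ y) (sub_nonneg.2 hs.2) hs.1.le (by ring)
    have hxy : (1 - s) • x + s • y = x + s • (y - x) := by module
    rw [hxy] at h
    simp only [smul_eq_mul] at h
    simp only [zero_smul, add_zero, zero_mul, sub_zero]
    linarith

/-- First order necessary conditions with multipliers for a problem whose constraints have
linearly independent gradients and values in a (possibly nonconvex) cone `C`. -/
theorem exists_multipliers_of_cone_constraint [CompleteSpace E] {ι : Type*} [Fintype ι]
    {c : ι → E → ℝ} {c' : ι → E →L[ℝ] ℝ} {θ : E → ℝ} {θ' : E →L[ℝ] ℝ} {a : E}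
    (hc : ∀ i, HasStrictFDerivAt (c i) (c' i) a) (hθ : HasStrictFDerivAt θ θ' a)
    (hli : LinearIndependent ℝ c') {C : Set (ι → ℝ)} (hC0 : 0 ∈ C)
    (hC : ∀ t ∈ C, ∀ s : ℝ, 0 ≤ s → s • t ∈ C)
    (hmin : ∀ᶠ w in 𝓝 a, (fun i => c i w - c i a) ∈ C → θ a ≤ θ w) :
    ∃ μ : ι → ℝ, θ' = ∑ i, μ i • c' i ∧ ∀ t ∈ C, 0 ≤ ∑ i, μ i * t i := by
  classical
  have hmult : ∃ μ : ι → ℝ, θ' = ∑ i, μ i • c' i := by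
    have hext : IsLocalExtrOn θ {w | ∀ i, c i w = c i a} a := by
      refine Or.inl (eventually_nhdsWithin_iff.2 ?_)
      filter_upwards [hmin] with w hw hwa
      refine hw ?_
      convert hC0 using 1
      ext i
      simp [hwa i]
    obtain ⟨Λ, Λ₀, hne, hsum⟩ := hext.exists_multipliers_of_hasStrictFDerivAt hc hθ
    have hΛ₀ : Λ₀ ≠ 0 := by
      rintro rfl
      rw [zero_smul, add_zero] at hsum
      exact hne (Prod.ext (funext (Fintype.linearIndependent_iff.1 hli Λ hsum)) rfl)
    refine ⟨fun i => -(Λ₀⁻¹ * Λ i), ?_⟩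
    have h1 : Λ₀ • θ' = -∑ i, Λ i • c' i := eq_neg_of_add_eq_zero_right hsum
    calc θ' = Λ₀⁻¹ • (Λ₀ • θ') := by rw [smul_smul, inv_mul_cancel₀ hΛ₀, one_smul]
      _ = _ := by
        rw [h1]
        ext v
        simp [Finset.mul_sum, mul_assoc]
  obtain ⟨μ, hμ⟩ := hmult
  refine ⟨μ, hμ, fun t ht => ?_⟩
  choose v hv using fun j : ι => hli.pi_surjective (Pi.single j 1)
  let R : (ι → ℝ) →L[ℝ] E :=
    ∑ j, (ContinuousLinearMap.proj (R := ℝ) (φ := fun _ : ι => ℝ) j).smulRight (v j)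
  have hR (s : ι → ℝ) : R s = ∑ j, s j • v j := by simp [R]
  have hcR (i : ι) (s : ι → ℝ) : c' i (R s) = s i := by
    have hvi (j : ι) : c' i (v j) = (Pi.single j 1 : ι → ℝ) i := congrFun (hv j) i
    simp [hR, hvi, Pi.single_apply]
  let Φ : (ι → ℝ) → (ι → ℝ) := fun s i => c i (a + R s)
  have hin : HasStrictFDerivAt (fun s : ι → ℝ => a + R s) R 0 :=
    R.hasStrictFDerivAt.const_add a
  have ha0 : a + R 0 = a := by simp
  have hΦ : HasStrictFDerivAt Φ
      (ContinuousLinearEquiv.refl ℝ (ι → ℝ) : (ι → ℝ) →L[ℝ] (ι → ℝ)) 0 := by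
    refine hasStrictFDerivAt_pi'.2 fun i => ?_
    have h := HasStrictFDerivAt.comp (g := c i) (g' := c' i) 0 (by rw [ha0]; exact hc i) hin
    refine h.congr_fderiv ?_
    ext s
    simp [hcR]
  set ψ := hΦ.localInverse with hψ
  have hψ0 : ψ (Φ 0) = 0 := hΦ.localInverse_apply_image
  have hline : HasDerivAt (fun s : ℝ => Φ 0 + s • t) t 0 := by
    simpa using ((hasDerivAt_id (0 : ℝ)).smul_const t).const_add (Φ 0)
  have hline0 : Φ 0 + (0 : ℝ) • t = Φ 0 := by simp
  have hψd : HasDerivAt (fun s : ℝ => ψ (Φ 0 + s • t)) t 0 := by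
    have h := HasFDerivAt.comp_hasDerivAt (l := ψ) (0 : ℝ)
      (by rw [hline0]; exact hΦ.to_localInverse.hasFDerivAt) hline
    simpa using! h
  have hγ : HasDerivAt (fun s : ℝ => a + R (ψ (Φ 0 + s • t))) (R t) 0 :=
    (R.hasFDerivAt.comp_hasDerivAt (0 : ℝ) hψd).const_add a
  have hγ0 : a + R (ψ (Φ 0 + (0 : ℝ) • t)) = a := by rw [hline0, hψ0, ha0]
  have hθd : HasDerivAt (fun s : ℝ => θ (a + R (ψ (Φ 0 + s • t)))) (θ' (R t)) 0 :=
    HasFDerivAt.comp_hasDerivAt (l := θ) (0 : ℝ) (by rw [hγ0]; exact hθ.hasFDerivAt) hγ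
  have hθR : θ' (R t) = ∑ i, μ i * t i := by
    simp [hμ, hcR]
  rw [← hθR]
  refine hθd.nonneg_of_eventually_ge_right ?_
  have hev1 : ∀ᶠ s in 𝓝[>] (0 : ℝ), Φ (ψ (Φ 0 + s • t)) = Φ 0 + s • t := by
    have hcont := hline.continuousAt.tendsto
    rw [hline0] at hcont
    exact (hcont.eventually hΦ.eventually_right_inverse).filter_mono nhdsWithin_le_nhds
  have hev2 := hγ.continuousAt.tendsto
  rw [hγ0] at hev2
  filter_upwards [hev1, (hev2.eventually hmin).filter_mono nhdsWithin_le_nhds,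
    self_mem_nhdsWithin] with s hs1 hs2 hs0
  rw [hγ0]
  refine hs2 ?_
  convert hC t ht s (le_of_lt hs0) using 1
  ext i
  have h1 : c i (a + R (ψ (Φ 0 + s • t))) = c i (a + R 0) + s * t i := congrFun hs1 i
  rw [h1, ha0]
  simp

end GeneralLemmas

section PartialGradients

variable {E₁ E₂ E₃ : Type*}
  [NormedAddCommGroup E₁] [InnerProductSpace ℝ E₁]
  [NormedAddCommGroup E₂] [InnerProductSpace ℝ E₂]
  [NormedAddCommGroup E₃] [NormedSpace ℝ E₃]
  {φ : E₁ × E₂ × E₃ → ℝ} {a : E₁} {b : E₂} {c : E₃}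

theorem inner_gradient_fst [CompleteSpace E₁] (hφ : DifferentiableAt ℝ φ (a, b, c)) (v : E₁) :
    ⟪gradient (fun x => φ (x, b, c)) a, v⟫ = fderiv ℝ φ (a, b, c) (v, 0, 0) := by
  have h := hφ.hasFDerivAt.comp a (hasFDerivAt_prodMk_left (𝕜 := ℝ) a (b, c))
  rw [inner_gradient_left]
  exact congrArg (· v) h.fderiv

theorem inner_gradient_snd [CompleteSpace E₂] (hφ : DifferentiableAt ℝ φ (a, b, c)) (v : E₂) :
    ⟪gradient (fun y => φ (a, y, c)) b, v⟫ = fderiv ℝ φ (a, b, c) (0, v, 0) := by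
  have h := hφ.hasFDerivAt.comp b
    ((hasFDerivAt_prodMk_right (𝕜 := ℝ) a (b, c)).comp b
      (hasFDerivAt_prodMk_left (𝕜 := ℝ) b c))
  rw [inner_gradient_left]
  exact congrArg (· v) h.fderiv

theorem fderiv_apply_third (hφ : DifferentiableAt ℝ φ (a, b, c)) (v : E₃) :
    fderiv ℝ φ (a, b, c) (0, 0, v) = fderiv ℝ (fun z => φ (a, b, z)) c v := by
  have h := hφ.hasFDerivAt.comp c
    ((hasFDerivAt_prodMk_right (𝕜 := ℝ) a (b, c)).comp c
      (hasFDerivAt_prodMk_right (𝕜 := ℝ) b c))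
  exact (congrArg (· v) h.fderiv).symm

end PartialGradients

theorem sum_subtype_eq_sum_of_eq_zero {ι M : Type*} [Fintype ι] [AddCommMonoid M] {p : ι → Prop}
    [Fintype {i // p i}] {F : ι → M} (hF : ∀ i, ¬ p i → F i = 0) :
    ∑ i : {i // p i}, F i = ∑ i, F i := by
  classical
  rw [← Finset.sum_subtype (Finset.univ.filter p) (by simp) F]
  refine Finset.sum_filter_of_ne fun i _ hi => ?_
  by_contra hp
  exact hi (hF i hp)

theorem mem_limNC_of_hasGradientAt {n : ℕ} {X : Set (EuclideanSpace ℝ (Fin n))}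
    {φ : EuclideanSpace ℝ (Fin n) → ℝ} {x₀ ξ : EuclideanSpace ℝ (Fin n)} (hx₀ : x₀ ∈ X)
    (hφ : HasGradientAt φ ξ x₀) (hφ₀ : φ x₀ = 0) (hφX : ∀ x ∈ X, φ x ≤ 0) :
    ξ ∈ limNC X x₀ := by
  refine ⟨fun _ => x₀, fun _ => ξ, fun _ => hx₀, fun _ ε hε => ?_,
    tendsto_const_nhds, tendsto_const_nhds⟩
  obtain ⟨δ, hδ, hball⟩ :=
    Metric.eventually_nhds_iff.1 ((hasGradientAt_iff_isLittleO.1 hφ).def hε)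
  refine ⟨δ, hδ, fun x hx hxδ => ?_⟩
  have h := (abs_le.1 (hball (by rwa [dist_eq_norm] : dist x x₀ < δ))).1
  rw [hφ₀] at h
  have := hφX x hx
  linarith

section Lagrangian

variable {n m q : ℕ} {f : EuclideanSpace ℝ (Fin n) → EuclideanSpace ℝ (Fin m) → ℝ}
  {g : EuclideanSpace ℝ (Fin n) → EuclideanSpace ℝ (Fin m) → Fin q → ℝ}

theorem gradyL_eq_sub_sum {x : EuclideanSpace ℝ (Fin n)} {y : EuclideanSpace ℝ (Fin m)}
    (hf : DifferentiableAt ℝ (f x) y) (hg : ∀ i, DifferentiableAt ℝ (fun y' => g x y' i) y)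
    (lam : Fin q → ℝ) :
    gradyL f g x y lam = grady f x y - ∑ i, lam i • grady (fun x y => g x y i) x y := by
  refine ext_inner_right ℝ fun v => ?_
  have h : HasFDerivAt (fun y' => f x y' - ∑ i, lam i * g x y' i)
      (fderiv ℝ (f x) y - ∑ i, lam i • fderiv ℝ (fun y' => g x y' i) y) y :=
    hf.hasFDerivAt.sub
      (HasFDerivAt.fun_sum fun i _ => (hg i).hasFDerivAt.const_mul (lam i))
  simp only [gradyL, grady, Lag, inner_gradient_left, inner_sub_left, sum_inner,
    real_inner_smul_left, h.fderiv]
  simp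

theorem contDiff_gradyL
    (hf : ContDiff ℝ 2 (fun p : EuclideanSpace ℝ (Fin n) × EuclideanSpace ℝ (Fin m) => f p.1 p.2))
    (hg : ∀ i, ContDiff ℝ 2
      (fun p : EuclideanSpace ℝ (Fin n) × EuclideanSpace ℝ (Fin m) => g p.1 p.2 i)) :
    ContDiff ℝ 1 (fun w : EuclideanSpace ℝ (Fin n) × EuclideanSpace ℝ (Fin m) × (Fin q → ℝ) =>
      gradyL f g w.1 w.2.1 w.2.2) := by
  refine (InnerProductSpace.toDual ℝ _).symm.contDiff.comp (ContDiff.fderiv (m := 2)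
    (f := fun (w : EuclideanSpace ℝ (Fin n) × EuclideanSpace ℝ (Fin m) × (Fin q → ℝ)) y' =>
      Lag f g w.1 y' w.2.2) (g := fun w => w.2.1) ?_ (by fun_prop) (by norm_num))
  have hp : ContDiff ℝ 2 (fun p : (EuclideanSpace ℝ (Fin n) × EuclideanSpace ℝ (Fin m) ×
      (Fin q → ℝ)) × EuclideanSpace ℝ (Fin m) => (p.1.1, p.2)) := by fun_prop
  refine (hf.comp hp).sub (ContDiff.sum fun i _ => ContDiff.mul ?_ ((hg i).comp hp))
  fun_prop

/-- For a convex lower-level problem, KKT points are global solutions. -/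
theorem le_of_mem_SigmaSet {x : EuclideanSpace ℝ (Fin n)} {y : EuclideanSpace ℝ (Fin m)}
    {lam : Fin q → ℝ} (hf : Differentiable ℝ (f x)) (hg : ∀ i, Differentiable ℝ (fun y => g x y i))
    (hfc : ConcaveOn ℝ Set.univ (f x)) (hgc : ∀ i, ConvexOn ℝ Set.univ (fun y => g x y i))
    (hlam : lam ∈ SigmaSet f g x y) {y' : EuclideanSpace ℝ (Fin m)} (hy' : y' ∈ Feas g x) :
    f x y' ≤ f x y := by
  obtain ⟨hgrad, hnn, -, hcompl⟩ := hlam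
  have hconc : ConcaveOn ℝ Set.univ (fun y => Lag f g x y lam) := by
    have hsum : ConvexOn ℝ Set.univ (∑ i, lam i • fun y => g x y i) :=
      Finset.sum_induction _ (fun F : EuclideanSpace ℝ (Fin m) → ℝ => ConvexOn ℝ Set.univ F)
        (fun _ _ => ConvexOn.add) (convexOn_const 0 convex_univ)
        (fun i _ => (hgc i).smul (hnn i))
    have heq : (fun y => Lag f g x y lam) = f x - ∑ i, lam i • fun y => g x y i := by
      ext y
      simp [Lag]
    rw [heq]
    exact hfc.sub hsum
  have hdiff : Differentiable ℝ (fun y => Lag f g x y lam) :=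
    hf.sub (Differentiable.fun_sum fun i _ => (hg i).const_mul (lam i))
  have hzero : HasFDerivAt (fun y => Lag f g x y lam) (0 : _ →L[ℝ] ℝ) y := by
    have h := (hdiff y).hasFDerivAt
    rwa [← toDual_gradient, show gradient (fun y => Lag f g x y lam) y = 0 from hgrad,
      map_zero] at h
  have hle := hconc.le_of_hasFDerivAt_zero hzero y'
  have hsum : ∑ i, lam i * g x y' i ≤ 0 :=
    Finset.sum_nonpos fun i _ => mul_nonpos_of_nonneg_of_nonpos (hnn i) (hy' i)
  simp only [Lag, hcompl] at hle
  linarith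

/-- A local Stackelberg solution locally minimizes `f` over the MPEC feasible region, the
localization being needed in `x` only. -/
theorem StackelbergLocal.eventually_le {X : Set (EuclideanSpace ℝ (Fin n))}
    {xb : EuclideanSpace ℝ (Fin n)} {yb : EuclideanSpace ℝ (Fin m)}
    (hstack : StackelbergLocal f g X xb yb)
    (hf : ∀ x, Differentiable ℝ (f x)) (hg : ∀ x i, Differentiable ℝ (fun y => g x y i))
    (hconv : ∀ x ∈ X, ConcaveOn ℝ Set.univ (f x) ∧ ∀ i, ConvexOn ℝ Set.univ (fun y => g x y i)) :
    ∀ᶠ x in 𝓝 xb, ∀ y lam, (x, y, lam) ∈ MPECFeas f g X → f xb yb ≤ f x y := by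
  filter_upwards [eventually_nhdsWithin_iff.1 hstack.2.2] with x hx y lam hw
  have h := hx hw.1
  rw [← hstack.2.1.2] at h
  rw [← EReal.coe_le_coe_iff]
  refine h.trans (sSup_le ?_)
  rintro _ ⟨y', hy', rfl⟩
  exact EReal.coe_le_coe_iff.2
    (le_of_mem_SigmaSet (hf x) (hg x) (hconv x hw.1).1 (hconv x hw.1).2
      ⟨hw.2.1, hw.2.2.2.1, hw.2.2.1, hw.2.2.2.2⟩ hy')

end Lagrangian

/-- Theorem 4.2 — under MPEC-LICQ, a local Stackelberg solution yields an
S-stationary point of the MPEC reformulation. -/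
theorem stmt14 {n m q r : ℕ}
    (f : EuclideanSpace ℝ (Fin n) → EuclideanSpace ℝ (Fin m) → ℝ)
    (g : EuclideanSpace ℝ (Fin n) → EuclideanSpace ℝ (Fin m) → Fin q → ℝ)
    (h : EuclideanSpace ℝ (Fin n) → Fin r → ℝ)
    (hf : ContDiff ℝ 2 (fun p : EuclideanSpace ℝ (Fin n) × EuclideanSpace ℝ (Fin m) => f p.1 p.2))
    (hg : ∀ i, ContDiff ℝ 2
      (fun p : EuclideanSpace ℝ (Fin n) × EuclideanSpace ℝ (Fin m) => g p.1 p.2 i))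
    (hh : ∀ j, ContDiff ℝ 1 (fun x => h x j))
    (X : Set (EuclideanSpace ℝ (Fin n))) (hX : X = {x | ∀ j, h x j ≤ 0})
    (hconv : ∀ x ∈ X, ConcaveOn ℝ Set.univ (f x) ∧ ∀ i, ConvexOn ℝ Set.univ (fun y => g x y i))
    (xb : EuclideanSpace ℝ (Fin n)) (yb : EuclideanSpace ℝ (Fin m)) (lamb : Fin q → ℝ)
    (hstack : StackelbergLocal f g X xb yb)
    (hlamb : lamb ∈ SigmaSet f g xb yb)
    (hlicq : LinearIndependent ℝ (Sum.elim
      (fun j : {j : Fin r // h xb j = 0} =>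
        fderiv ℝ (fun w : EuclideanSpace ℝ (Fin n) × EuclideanSpace ℝ (Fin m) × (Fin q → ℝ)
          => h w.1 j.1) (xb, yb, lamb))
      (Sum.elim
        (fun jm : Fin m =>
          fderiv ℝ (fun w : EuclideanSpace ℝ (Fin n) × EuclideanSpace ℝ (Fin m) × (Fin q → ℝ)
            => gradyL f g w.1 w.2.1 w.2.2 jm) (xb, yb, lamb))
        (Sum.elim
          (fun i : {i : Fin q // g xb yb i = 0} =>
            fderiv ℝ (fun w : EuclideanSpace ℝ (Fin n) × EuclideanSpace ℝ (Fin m) × (Fin q → ℝ)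
              => g w.1 w.2.1 i.1) (xb, yb, lamb))
          (fun i : {i : Fin q // lamb i = 0} =>
            fderiv ℝ (fun w : EuclideanSpace ℝ (Fin n) × EuclideanSpace ℝ (Fin m) × (Fin q → ℝ)
              => w.2.2 i.1) (xb, yb, lamb)))))) :
    SStationary f g X xb yb lamb := by
  classical
  set wb : EuclideanSpace ℝ (Fin n) × EuclideanSpace ℝ (Fin m) × (Fin q → ℝ) := (xb, yb, lamb)
    with hwb
  have hxbX : xb ∈ X := hstack.1
  obtain ⟨hgrad, hnn, hgle, hcompl⟩ := id hlamb
  have hcompl_i : ∀ i, lamb i * g xb yb i = 0 := fun i =>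
    (Finset.sum_eq_zero_iff_of_nonpos
      fun i _ => mul_nonpos_of_nonneg_of_nonpos (hnn i) (hgle i)).1 hcompl i (Finset.mem_univ i)
  -- Smoothness of the data as functions of the joint variable.
  have hpair : ContDiff ℝ 2
      (fun w : EuclideanSpace ℝ (Fin n) × EuclideanSpace ℝ (Fin m) × (Fin q → ℝ) =>
        (w.1, w.2.1)) := by fun_prop
  have hfW : ContDiff ℝ 2
      (fun w : EuclideanSpace ℝ (Fin n) × EuclideanSpace ℝ (Fin m) × (Fin q → ℝ) =>
        f w.1 w.2.1) := hf.comp hpair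
  have hgW (i : Fin q) : ContDiff ℝ 2
      (fun w : EuclideanSpace ℝ (Fin n) × EuclideanSpace ℝ (Fin m) × (Fin q → ℝ) =>
        g w.1 w.2.1 i) := (hg i).comp hpair
  have hhW (j : Fin r) : ContDiff ℝ 1
      (fun w : EuclideanSpace ℝ (Fin n) × EuclideanSpace ℝ (Fin m) × (Fin q → ℝ) =>
        h w.1 j) := (hh j).comp contDiff_fst
  have hLW := contDiff_gradyL hf hg
  have hLWk (k : Fin m) : ContDiff ℝ 1
      (fun w : EuclideanSpace ℝ (Fin n) × EuclideanSpace ℝ (Fin m) × (Fin q → ℝ) =>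
        gradyL f g w.1 w.2.1 w.2.2 k) := contDiff_euclidean.1 hLW k
  have hfy (x : EuclideanSpace ℝ (Fin n)) : Differentiable ℝ (f x) :=
    (hf.differentiable (by norm_num)).comp (f := fun y => (x, y)) (by fun_prop)
  have hgy (x : EuclideanSpace ℝ (Fin n)) (i : Fin q) : Differentiable ℝ (fun y => g x y i) :=
    ((hg i).differentiable (by norm_num)).comp (f := fun y => (x, y)) (by fun_prop)
  -- The cone encoding the linearized MPEC constraints.
  let C : Set ({j : Fin r // h xb j = 0} ⊕ Fin m ⊕ {i : Fin q // g xb yb i = 0} ⊕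
      {i : Fin q // lamb i = 0} → ℝ) :=
    {t | (∀ j, t (.inl j) ≤ 0) ∧ (∀ k, t (.inr (.inl k)) = 0) ∧
      (∀ i, t (.inr (.inr (.inl i))) ≤ 0 ∧ (0 < lamb i → t (.inr (.inr (.inl i))) = 0)) ∧
      (∀ i, 0 ≤ t (.inr (.inr (.inr i))) ∧ (g xb yb i < 0 → t (.inr (.inr (.inr i))) = 0)) ∧
      ∀ i hgi hli, t (.inr (.inr (.inl ⟨i, hgi⟩))) * t (.inr (.inr (.inr ⟨i, hli⟩))) = 0}
  have hCcone : ∀ t ∈ C, ∀ s : ℝ, 0 ≤ s → s • t ∈ C := by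
    rintro t ⟨h1, h2, h3, h4, h5⟩ s hs
    refine ⟨fun j => mul_nonpos_of_nonneg_of_nonpos hs (h1 j), fun k => ?_,
      fun i => ⟨mul_nonpos_of_nonneg_of_nonpos hs (h3 i).1, fun hi => ?_⟩,
      fun i => ⟨mul_nonneg hs (h4 i).1, fun hi => ?_⟩, fun i hgi hli => ?_⟩
    · simp [h2 k]
    · simp [(h3 i).2 hi]
    · simp [(h4 i).2 hi]
    · have := h5 i hgi hli
      simp only [Pi.smul_apply, smul_eq_mul]
      linear_combination s ^ 2 * this
  let c : {j : Fin r // h xb j = 0} ⊕ Fin m ⊕ {i : Fin q // g xb yb i = 0} ⊕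
      {i : Fin q // lamb i = 0} →
      EuclideanSpace ℝ (Fin n) × EuclideanSpace ℝ (Fin m) × (Fin q → ℝ) → ℝ :=
    Sum.elim (fun j w => h w.1 j.1) (Sum.elim (fun k w => gradyL f g w.1 w.2.1 w.2.2 k)
      (Sum.elim (fun i w => g w.1 w.2.1 i.1) (fun i w => w.2.2 i.1)))
  have hmin : ∀ᶠ w in 𝓝 wb, (fun k => c k w - c k wb) ∈ C → f wb.1 wb.2.1 ≤ f w.1 w.2.1 := by
    have hst := (continuous_fst.tendsto wb).eventually (hstack.eventually_le hfy hgy hconv)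
    have hev_h : ∀ᶠ w in 𝓝 wb, ∀ j, h xb j < 0 → h w.1 j < 0 :=
      eventually_all.2 fun j => by
        by_cases hj : h xb j < 0
        · filter_upwards [(hhW j).continuous.continuousAt.eventually_lt_const
            (show _ < (0 : ℝ) from hj)] with w hw _ using hw
        · simp [hj]
    have hev_g : ∀ᶠ w in 𝓝 wb, ∀ i, g xb yb i < 0 → g w.1 w.2.1 i < 0 :=
      eventually_all.2 fun i => by
        by_cases hi : g xb yb i < 0
        · filter_upwards [(hgW i).continuous.continuousAt.eventually_lt_const
            (show _ < (0 : ℝ) from hi)] with w hw _ using hw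
        · simp [hi]
    have hev_l : ∀ᶠ w in 𝓝 wb, ∀ i, 0 < lamb i → 0 < w.2.2 i :=
      eventually_all.2 fun i => by
        by_cases hi : 0 < lamb i
        · have hcont : Continuous
              (fun w : EuclideanSpace ℝ (Fin n) × EuclideanSpace ℝ (Fin m) × (Fin q → ℝ) =>
                w.2.2 i) := by fun_prop
          filter_upwards [hcont.continuousAt.eventually_const_lt
            (show (0 : ℝ) < _ from hi)] with w hw _ using hw
        · simp [hi]
    filter_upwards [hst, hev_h, hev_g, hev_l] with w hw hwh hwg hwl ⟨h1, h2, h3, h4, h5⟩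
    refine hw w.2.1 w.2.2 ⟨?_, ?_, fun i => ?_, fun i => ?_, Finset.sum_eq_zero fun i _ => ?_⟩
    · rw [hX]
      intro j
      rw [hX] at hxbX
      rcases (hxbX j).lt_or_eq with hj | hj
      · exact (hwh j hj).le
      · have := h1 ⟨j, hj⟩
        simpa [c, hwb, hj] using this
    · ext k
      have := h2 k
      simpa [c, hwb, hgrad] using this
    · rcases (hgle i).lt_or_eq with hi | hi
      · exact (hwg i hi).le
      · have := (h3 ⟨i, hi⟩).1
        simpa [c, hwb, hi] using this
    · rcases (hnn i).lt_or_eq with hi | hi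
      · exact (hwl i hi).le
      · have := (h4 ⟨i, hi.symm⟩).1
        simpa [c, hwb, ← hi] using this
    · change w.2.2 i * g w.1 w.2.1 i = 0
      rcases (hnn i).lt_or_eq with hi | hi
      · have hgi : g xb yb i = 0 := (mul_eq_zero.1 (hcompl_i i)).resolve_left hi.ne'
        have := (h3 ⟨i, hgi⟩).2 hi
        simp only [c, hwb, Sum.elim_inr, Sum.elim_inl, hgi, sub_zero] at this
        rw [this, mul_zero]
      · rcases (hgle i).lt_or_eq with hgi | hgi
        · have := (h4 ⟨i, hi.symm⟩).2 hgi
          simp only [c, hwb, Sum.elim_inr, ← hi, sub_zero] at this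
          rw [this, zero_mul]
        · have := h5 i hgi hi.symm
          simp only [c, hwb, Sum.elim_inr, Sum.elim_inl, ← hi, hgi, sub_zero] at this
          rw [mul_comm, this]
  obtain ⟨μ, hμ, hμC⟩ := exists_multipliers_of_cone_constraint (c := c)
    (θ := fun w => f w.1 w.2.1) (C := C) (a := wb) (fun k => by
      rcases k with j | k | i | i
      · exact (hhW j).hasStrictFDerivAt one_ne_zero
      · exact (hLWk k).hasStrictFDerivAt one_ne_zero
      · exact (hgW i).hasStrictFDerivAt two_ne_zero
      · have hl : ContDiff ℝ 1
            (fun w : EuclideanSpace ℝ (Fin n) × EuclideanSpace ℝ (Fin m) × (Fin q → ℝ) =>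
              w.2.2 i.1) := by fun_prop
        exact hl.hasStrictFDerivAt one_ne_zero)
    (hfW.hasStrictFDerivAt two_ne_zero) hlicq (by simp [C]) hCcone hmin
  -- Signs of the multipliers.
  have hμh (j) : μ (.inl j) ≤ 0 := by
    have := hμC (Pi.single (.inl j) (-1)) (by
      refine ⟨fun j' => ?_, by simp, by simp, by simp, by simp⟩
      by_cases hj : j' = j <;> simp [hj])
    simpa [Pi.single_apply] using this
  have hμg (i) (hi : lamb i.1 = 0) : μ (.inr (.inr (.inl i))) ≤ 0 := by
    have := hμC (Pi.single (.inr (.inr (.inl i))) (-1)) (by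
      refine ⟨by simp, by simp, fun i' => ?_, by simp, by simp⟩
      by_cases hj : i' = i <;> simp [hj, hi])
    simpa [Pi.single_apply] using this
  have hμl (i) (hi : g xb yb i.1 = 0) : 0 ≤ μ (.inr (.inr (.inr i))) := by
    have := hμC (Pi.single (.inr (.inr (.inr i))) 1) (by
      refine ⟨by simp, by simp, by simp, fun i' => ?_, by simp⟩
      by_cases hj : i' = i <;> simp [hj, hi])
    simpa [Pi.single_apply] using this
  let u : EuclideanSpace ℝ (Fin m) := WithLp.toLp 2 fun k => -μ (.inr (.inl k))
  let α : Fin q → ℝ := fun i =>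
    if hi : g xb yb i = 0 then -μ (.inr (.inr (.inl ⟨i, hi⟩))) else 0
  let β : Fin q → ℝ := fun i =>
    if hi : lamb i = 0 then μ (.inr (.inr (.inr ⟨i, hi⟩))) else 0
  have hinner_u (z : EuclideanSpace ℝ (Fin m)) : ⟪z, u⟫ = -∑ k, μ (.inr (.inl k)) * z k := by
    simp [u, PiLp.inner_apply, Finset.sum_neg_distrib]
  have hLd (k : Fin m) := (hLWk k).differentiable one_ne_zero wb
  have hLu : DifferentiableAt ℝ
      (fun w : EuclideanSpace ℝ (Fin n) × EuclideanSpace ℝ (Fin m) × (Fin q → ℝ) =>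
        ⟪gradyL f g w.1 w.2.1 w.2.2, u⟫) wb :=
    (hLW.differentiable one_ne_zero wb).inner ℝ (differentiableAt_const u)
  have hLu_fderiv (v) : fderiv ℝ
      (fun w : EuclideanSpace ℝ (Fin n) × EuclideanSpace ℝ (Fin m) × (Fin q → ℝ) =>
        ⟪gradyL f g w.1 w.2.1 w.2.2, u⟫) wb v = -∑ k, μ (.inr (.inl k)) * fderiv ℝ
      (fun w : EuclideanSpace ℝ (Fin n) × EuclideanSpace ℝ (Fin m) × (Fin q → ℝ) =>
        gradyL f g w.1 w.2.1 w.2.2 k) wb v := by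
    simp only [hinner_u]
    rw [(HasFDerivAt.fun_sum fun k _ => (hLd k).hasFDerivAt.const_mul
      (μ (.inr (.inl k)))).fun_neg.fderiv]
    simp
  -- The multiplier rule, evaluated at a direction.
  have hrule (v : EuclideanSpace ℝ (Fin n) × EuclideanSpace ℝ (Fin m) × (Fin q → ℝ)) :
      fderiv ℝ (fun w : EuclideanSpace ℝ (Fin n) × EuclideanSpace ℝ (Fin m) × (Fin q → ℝ) =>
          f w.1 w.2.1) wb v +
        ∑ i, α i * fderiv ℝ
          (fun w : EuclideanSpace ℝ (Fin n) × EuclideanSpace ℝ (Fin m) × (Fin q → ℝ) =>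
            g w.1 w.2.1 i) wb v +
        fderiv ℝ (fun w : EuclideanSpace ℝ (Fin n) × EuclideanSpace ℝ (Fin m) × (Fin q → ℝ) =>
          ⟪gradyL f g w.1 w.2.1 w.2.2, u⟫) wb v =
      ∑ j : {j : Fin r // h xb j = 0}, μ (.inl j) * fderiv ℝ (fun x => h x j.1) xb v.1 +
        ∑ i, β i * v.2.2 i := by
    have hα : ∑ i, α i * fderiv ℝ
          (fun w : EuclideanSpace ℝ (Fin n) × EuclideanSpace ℝ (Fin m) × (Fin q → ℝ) =>
            g w.1 w.2.1 i) wb v = -∑ i : {i : Fin q // g xb yb i = 0},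
        μ (.inr (.inr (.inl i))) * fderiv ℝ
          (fun w : EuclideanSpace ℝ (Fin n) × EuclideanSpace ℝ (Fin m) × (Fin q → ℝ) =>
            g w.1 w.2.1 i.1) wb v := by
      rw [← sum_subtype_eq_sum_of_eq_zero (p := fun i => g xb yb i = 0)
        (fun i hi => by simp [α, hi]), ← Finset.sum_neg_distrib]
      exact Finset.sum_congr rfl fun i _ => by simp [α, i.2]
    have hβ : ∑ i, β i * v.2.2 i = ∑ i : {i : Fin q // lamb i = 0},
        μ (.inr (.inr (.inr i))) * v.2.2 i := by
      rw [← sum_subtype_eq_sum_of_eq_zero (p := fun i => lamb i = 0)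
        (fun i hi => by simp [β, hi])]
      exact Finset.sum_congr rfl fun i _ => by simp [β, i.2]
    have hhd (j : Fin r) : fderiv ℝ
        (fun w : EuclideanSpace ℝ (Fin n) × EuclideanSpace ℝ (Fin m) × (Fin q → ℝ) =>
          h w.1 j) wb v = fderiv ℝ (fun x => h x j) xb v.1 := by
      have := (((hh j).differentiable one_ne_zero xb).hasFDerivAt.comp wb
        (hasFDerivAt_fst (𝕜 := ℝ))).fderiv
      exact congrArg (· v) this
    have hld (i : Fin q) : fderiv ℝ
        (fun w : EuclideanSpace ℝ (Fin n) × EuclideanSpace ℝ (Fin m) × (Fin q → ℝ) =>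
          w.2.2 i) wb v = v.2.2 i := by
      let P : EuclideanSpace ℝ (Fin n) × EuclideanSpace ℝ (Fin m) × (Fin q → ℝ) →L[ℝ] ℝ :=
        (ContinuousLinearMap.proj i).comp
          ((ContinuousLinearMap.snd ℝ _ _).comp (ContinuousLinearMap.snd ℝ _ _))
      exact congrArg (· v) P.hasFDerivAt.fderiv
    have hv := congrArg (· v) hμ
    simp only [Fintype.sum_sum_type, Sum.elim_inl, Sum.elim_inr, add_apply,
      sum_apply, smul_apply, smul_eq_mul, hhd, hld] at hv
    rw [hα, hβ, hLu_fderiv]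
    linarith
  have hfd := hfW.differentiable two_ne_zero wb
  have hgd := fun i => (hgW i).differentiable two_ne_zero wb
  have hgLam (i : Fin q) : ⟪grady (fun x y => g x y i) xb yb, u⟫ = -β i := by
    have h0 := hrule (0, 0, Pi.single i 1)
    have hf0 : fderiv ℝ
        (fun w : EuclideanSpace ℝ (Fin n) × EuclideanSpace ℝ (Fin m) × (Fin q → ℝ) =>
          f w.1 w.2.1) wb (0, 0, Pi.single i 1) = 0 := by
      rw [fderiv_apply_third hfd]
      simp
    have hg0 (i' : Fin q) : fderiv ℝ
        (fun w : EuclideanSpace ℝ (Fin n) × EuclideanSpace ℝ (Fin m) × (Fin q → ℝ) =>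
          g w.1 w.2.1 i') wb (0, 0, Pi.single i 1) = 0 := by
      rw [fderiv_apply_third (hgd i')]
      simp
    have haff : HasFDerivAt (fun lam : Fin q → ℝ => ⟪gradyL f g xb yb lam, u⟫)
        (0 - ∑ i', (ContinuousLinearMap.proj (R := ℝ) (φ := fun _ : Fin q => ℝ) i').smulRight
          ⟪grady (fun x y => g x y i') xb yb, u⟫) lamb := by
      simp only [gradyL_eq_sub_sum (hfy xb yb) (fun i' => hgy xb i' yb), inner_sub_left,
        sum_inner, real_inner_smul_left]
      refine (hasFDerivAt_const _ _).sub (HasFDerivAt.fun_sum fun i' _ => ?_)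
      exact (hasFDerivAt_apply i' lamb).mul_const' _
    rw [fderiv_apply_third hLu, haff.fderiv, hf0] at h0
    simp only [hg0] at h0
    simp [Pi.single_apply] at h0
    linarith
  refine ⟨u, α, β, ?_, ?_, fun i => ?_, fun i hi _ => ?_, fun i _ hi => ?_, fun i hi hi' => ?_⟩
  · refine mem_limNC_of_hasGradientAt
      (φ := fun x => ∑ j : {j : Fin r // h xb j = 0}, -μ (.inl j) * h x j.1) hxbX ?_ ?_ ?_
    · rw [hasGradientAt_iff_hasFDerivAt]
      have hsum := HasFDerivAt.fun_sum (u := Finset.univ)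
        fun (j : {j : Fin r // h xb j = 0}) _ =>
          ((hh j.1).differentiable one_ne_zero xb).hasFDerivAt.const_mul (-μ (.inl j))
      refine hsum.congr_fderiv ?_
      ext v
      have hv := hrule (v, 0, 0)
      have hgv (i : Fin q) : fderiv ℝ
          (fun w : EuclideanSpace ℝ (Fin n) × EuclideanSpace ℝ (Fin m) × (Fin q → ℝ) =>
            g w.1 w.2.1 i) wb (v, 0, 0) = ⟪gradx (fun x y => g x y i) xb yb, v⟫ :=
        (inner_gradient_fst (hgd i) v).symm
      rw [← inner_gradient_fst hLu, ← inner_gradient_fst hfd] at hv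
      simp only [hgv] at hv
      simp only [InnerProductSpace.toDual_apply_apply, inner_neg_left, inner_add_left, sum_inner,
        real_inner_smul_left]
      simp [Finset.sum_neg_distrib, gradx, hessxyLu] at hv ⊢
      linarith
    · exact Finset.sum_eq_zero fun j _ => by rw [j.2, mul_zero]
    · intro x hx
      rw [hX] at hx
      exact Finset.sum_nonpos fun j _ =>
        mul_nonpos_of_nonneg_of_nonpos (neg_nonneg.2 (hμh j)) (hx j.1)
  · refine ext_inner_right ℝ fun v => ?_
    have hv := hrule (0, v, 0)
    have hgv (i : Fin q) : fderiv ℝ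
        (fun w : EuclideanSpace ℝ (Fin n) × EuclideanSpace ℝ (Fin m) × (Fin q → ℝ) =>
          g w.1 w.2.1 i) wb (0, v, 0) = ⟪grady (fun x y => g x y i) xb yb, v⟫ :=
      (inner_gradient_snd (hgd i) v).symm
    rw [← inner_gradient_snd hLu, ← inner_gradient_snd hfd] at hv
    simp only [hgv] at hv
    simp only [inner_add_left, sum_inner, real_inner_smul_left, inner_zero_left]
    simpa [grady, hessyyLu] using hv
  · simp [gyTu, hgLam]
  · simp [α, hi.ne]
  · simp [β, hi.ne']
  · simp only [α, β, hi, hi', dite_true]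
    exact ⟨neg_nonneg.2 (hμg ⟨i, hi⟩ hi'), hμl ⟨i, hi'⟩ hi⟩
end

section
/- Suppose f(x,·) is concave and each g_i(x,·) is convex on ℝᵐ for all x ∈ X, and f, g are twice continuously differentiable. Let x̄ be an interior point of X and a local minimizer of V over X, let ȳ ∈ S(x̄), and suppose the KKT condition holds for (P_x̄) at ȳ with a multiplier λ̄ (i.e., λ̄ ∈ Σ(x̄,ȳ)), and a CQ holds at (x̄,ȳ,λ̄) for the constraint system {(x,y,λ) : ∇_y L(x,y,λ) = 0, λ ≥ 0}. Then there exists ū ∈ ℝᵐ such that: ∇_x L(x̄,ȳ,λ̄) + ∇²_{xy}L(x̄,ȳ,λ̄)ū = 0; ∇²_{yy}L(x̄,ȳ,λ̄)ū = 0; ∇_y L(x̄,ȳ,λ̄) = 0; −∇_y g(x̄,ȳ)ᵀū − g(x̄,ȳ) ≥ 0, λ̄ ≥ 0, λ̄ᵀ(−∇_y g(x̄,ȳ)ᵀū − g(x̄,ȳ)) = 0; and −g(x̄,ȳ) ≥ 0, λ̄ᵀg(x̄,ȳ) = 0. -/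
open Filter Topology Metric RealInnerProductSpace

/-- A critical point of a concave function is a global maximizer. -/
theorem ConcaveOn.le_of_fderiv_eq_zero {E : Type*} [NormedAddCommGroup E] [NormedSpace ℝ E]
    {h : E → ℝ} (hc : ConcaveOn ℝ Set.univ h) {y : E} (hd : DifferentiableAt ℝ h y)
    (h0 : fderiv ℝ h y = 0) (z : E) : h z ≤ h y := by
  have hline : ConcaveOn ℝ Set.univ (h ∘ AffineMap.lineMap (k := ℝ) y z) :=
    hc.comp_affineMap (AffineMap.lineMap y z)
  have hderiv : HasDerivAt (h ∘ AffineMap.lineMap (k := ℝ) y z) 0 0 := by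
    have hy : HasFDerivAt h (0 : E →L[ℝ] ℝ) (AffineMap.lineMap (k := ℝ) y z (0 : ℝ)) := by
      simpa [h0] using hd.hasFDerivAt
    simpa using hy.comp_hasDerivAt (0 : ℝ) AffineMap.hasDerivAt_lineMap
  have hs := hline.slope_le_of_hasDerivAt (Set.mem_univ 0) (Set.mem_univ 1) one_pos hderiv
  simpa [slope_def_field] using hs

section PartialDerivatives

variable {E F G H : Type*} [NormedAddCommGroup E] [NormedSpace ℝ E]
  [NormedAddCommGroup F] [NormedSpace ℝ F] [NormedAddCommGroup G] [NormedSpace ℝ G]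
  [NormedAddCommGroup H] [NormedSpace ℝ H] {φ : E × F × G → H} {φ' : E × F × G →L[ℝ] H}
  {a : E} {b : F} {c : G}

theorem HasFDerivAt.comp_triple_left (h : HasFDerivAt φ φ' (a, b, c)) :
    HasFDerivAt (fun x => φ (x, b, c)) (φ'.comp (ContinuousLinearMap.inl ℝ E (F × G))) a :=
  h.comp a (hasFDerivAt_prodMk_left a (b, c))

theorem HasFDerivAt.comp_triple_mid (h : HasFDerivAt φ φ' (a, b, c)) :
    HasFDerivAt (fun y => φ (a, y, c)) (φ'.comp ((ContinuousLinearMap.inr ℝ E (F × G)).comp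
      (ContinuousLinearMap.inl ℝ F G))) b :=
  h.comp b ((hasFDerivAt_prodMk_right a (b, c)).comp b (hasFDerivAt_prodMk_left b c))

theorem HasFDerivAt.comp_triple_right (h : HasFDerivAt φ φ' (a, b, c)) :
    HasFDerivAt (fun z => φ (a, b, z)) (φ'.comp ((ContinuousLinearMap.inr ℝ E (F × G)).comp
      (ContinuousLinearMap.inr ℝ F G))) c :=
  h.comp c ((hasFDerivAt_prodMk_right a (b, c)).comp c (hasFDerivAt_prodMk_right b c))

end PartialDerivatives

theorem hasFDerivAt_const_sub_sum_mul {ι : Type*} [Fintype ι] (a : ℝ) (b l : ι → ℝ) :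
    HasFDerivAt (fun l : ι → ℝ => a - ∑ k, l k * b k)
      (-∑ k, b k • ContinuousLinearMap.proj (R := ℝ) (φ := fun _ : ι => ℝ) k) l :=
  (HasFDerivAt.fun_sum fun k _ => (hasFDerivAt_apply k l).mul_const (b k)).const_sub a

/-- The derivative of a `C²` function in its middle variable along a fixed direction is
differentiable in all variables jointly. -/
theorem ContDiff.differentiable_inner_gradient_snd_fst {E F G : Type*}
    [NormedAddCommGroup E] [NormedSpace ℝ E]
    [NormedAddCommGroup F] [InnerProductSpace ℝ F] [CompleteSpace F]
    [NormedAddCommGroup G] [NormedSpace ℝ G] {θ : E × F × G → ℝ} (hθ : ContDiff ℝ 2 θ) (u : F) :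
    Differentiable ℝ fun w : E × F × G => ⟪gradient (fun y => θ (w.1, y, w.2.2)) w.2.1, u⟫ := by
  have heq : (fun w : E × F × G => ⟪gradient (fun y => θ (w.1, y, w.2.2)) w.2.1, u⟫) =
      fun w => fderiv ℝ θ w (0, u, 0) := by
    funext w
    rw [inner_gradient_left]
    have hθw : HasFDerivAt θ (fderiv ℝ θ w) (w.1, w.2.1, w.2.2) :=
      (hθ.differentiable (by norm_num) w).hasFDerivAt
    rw [hθw.comp_triple_mid.fderiv]
    simp
  rw [heq]
  exact ((hθ.fderiv_right (m := 1) (by norm_num)).differentiable (by norm_num)).clm_apply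
    (differentiable_const _)

section WolfeDual

variable {n m q : ℕ} {f : EuclideanSpace ℝ (Fin n) → EuclideanSpace ℝ (Fin m) → ℝ}
  {g : EuclideanSpace ℝ (Fin n) → EuclideanSpace ℝ (Fin m) → Fin q → ℝ}

theorem contDiff_Lag {k : WithTop ℕ∞}
    (hf : ContDiff ℝ k (fun p : EuclideanSpace ℝ (Fin n) × EuclideanSpace ℝ (Fin m) => f p.1 p.2))
    (hg : ∀ i, ContDiff ℝ k
      (fun p : EuclideanSpace ℝ (Fin n) × EuclideanSpace ℝ (Fin m) => g p.1 p.2 i)) :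
    ContDiff ℝ k
      fun w : EuclideanSpace ℝ (Fin n) × EuclideanSpace ℝ (Fin m) × (Fin q → ℝ) =>
        Lag f g w.1 w.2.1 w.2.2 := by
  have hp : ContDiff ℝ k
      fun w : EuclideanSpace ℝ (Fin n) × EuclideanSpace ℝ (Fin m) × (Fin q → ℝ) =>
        (w.1, w.2.1) := by fun_prop
  refine (hf.comp hp).sub (ContDiff.sum fun i _ => ContDiff.mul ?_ ((hg i).comp hp))
  fun_prop

/-- If `y` is a critical point of the Lagrangian with nonnegative multiplier for a concave program,
the Lagrangian bounds the maximal value from above. -/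
theorem Vfun_le_Lag {x : EuclideanSpace ℝ (Fin n)} (hf : ConcaveOn ℝ Set.univ (f x))
    (hg : ∀ i, ConvexOn ℝ Set.univ fun y => g x y i) {y : EuclideanSpace ℝ (Fin m)}
    {lam : Fin q → ℝ} (hd : DifferentiableAt ℝ (fun y' => Lag f g x y' lam) y)
    (hy : gradyL f g x y lam = 0) (hlam : ∀ i, 0 ≤ lam i) :
    Vfun f g x ≤ (Lag f g x y lam : EReal) := by
  have hsum : ConvexOn ℝ Set.univ fun y' => ∑ i, lam i * g x y' i := by
    refine ⟨convex_univ, fun a ha b hb s t hs ht hst => ?_⟩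
    simp only [Finset.smul_sum, ← Finset.sum_add_distrib]
    exact Finset.sum_le_sum fun i _ => ((hg i).smul (hlam i)).2 ha hb hs ht hst
  have hderiv : fderiv ℝ (fun y' => Lag f g x y' lam) y = 0 := by
    ext v
    rw [← inner_gradient_left, show gradient (fun y' => Lag f g x y' lam) y = 0 from hy]
    simp
  refine sSup_le ?_
  rintro _ ⟨z, hz, rfl⟩
  have hmax : Lag f g x z lam ≤ Lag f g x y lam :=
    (hf.sub hsum).le_of_fderiv_eq_zero hd hderiv z
  have hle : ∑ i, lam i * g x z i ≤ 0 :=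
    Finset.sum_nonpos fun i _ => mul_nonpos_of_nonneg_of_nonpos (hlam i) (hz i)
  have hfL : f x z ≤ Lag f g x z lam := by
    unfold Lag
    linarith
  exact EReal.coe_le_coe_iff.mpr (hfL.trans hmax)

theorem inner_gradyL {x : EuclideanSpace ℝ (Fin n)} {y : EuclideanSpace ℝ (Fin m)}
    (hf : DifferentiableAt ℝ (f x) y) (hg : ∀ i, DifferentiableAt ℝ (fun y' => g x y' i) y)
    (lam : Fin q → ℝ) (u : EuclideanSpace ℝ (Fin m)) :
    ⟪gradyL f g x y lam, u⟫ = ⟪grady f x y, u⟫ - ∑ i, lam i * gyTu g x y u i := by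
  have hL : HasFDerivAt (fun y' => Lag f g x y' lam)
      (fderiv ℝ (f x) y - ∑ i, lam i • fderiv ℝ (fun y' => g x y' i) y) y :=
    hf.hasFDerivAt.sub (HasFDerivAt.fun_sum fun i _ => (hg i).hasFDerivAt.const_mul (lam i))
  simp only [gradyL, gyTu, grady, inner_gradient_left]
  rw [hL.fderiv]
  simp

/-- At a KKT point of a concave program whose parameter is a local minimizer of the value function,
the Lagrangian has a local minimum over the Wolfe dual constraint system. -/
theorem isLocalMinOn_Lag_of_isLocalMinOn_Vfun {X : Set (EuclideanSpace ℝ (Fin n))}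
    (hL : ∀ x lam, Differentiable ℝ fun y => Lag f g x y lam)
    (hconv : ∀ x ∈ X, ConcaveOn ℝ Set.univ (f x) ∧ ∀ i, ConvexOn ℝ Set.univ (fun y => g x y i))
    {xb : EuclideanSpace ℝ (Fin n)} (hint : xb ∈ interior X)
    (hmin : IsLocalMinOn (Vfun f g) X xb)
    {yb : EuclideanSpace ℝ (Fin m)} (hyb : yb ∈ Sol f g xb)
    {lamb : Fin q → ℝ} (hlamb : ∑ i, lamb i * g xb yb i = 0) :
    IsLocalMinOn
      (fun w : EuclideanSpace ℝ (Fin n) × EuclideanSpace ℝ (Fin m) × (Fin q → ℝ) =>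
        Lag f g w.1 w.2.1 w.2.2)
      {w | (∀ i, WolfeG n m q w i ≤ 0) ∧ ∀ j, WolfeH f g w j = 0} (xb, yb, lamb) := by
  have hX : X ∈ 𝓝 xb := mem_interior_iff_mem_nhds.mp hint
  have hnear : ∀ᶠ w : EuclideanSpace ℝ (Fin n) × EuclideanSpace ℝ (Fin m) × (Fin q → ℝ) in
      𝓝 (xb, yb, lamb), w.1 ∈ X ∧ Vfun f g xb ≤ Vfun f g w.1 :=
    (continuousAt_fst (p := (xb, yb, lamb))).eventually
      (Filter.inter_mem hX (hmin.isLocalMin hX))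
  refine (hnear.filter_mono nhdsWithin_le_nhds).mp ?_
  filter_upwards [self_mem_nhdsWithin] with w hw hwX
  obtain ⟨x, y, lam⟩ := w
  have hlam : ∀ i, 0 ≤ lam i := fun i => by simpa [WolfeG] using hw.1 i
  have hy : gradyL f g x y lam = 0 := PiLp.ext hw.2
  have hle := Vfun_le_Lag (hconv x hwX.1).1 (hconv x hwX.1).2 (hL x lam y) hy hlam
  have hb : (Lag f g xb yb lamb : EReal) = Vfun f g xb := by
    rw [Lag, hlamb, sub_zero]
    exact hyb.2
  exact EReal.coe_le_coe_iff.mp ((hb.trans_le hwX.2).trans hle)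

end WolfeDual

/-- Theorem 4.3 — necessary optimality condition at an interior point via the
Wolfe duality approach. -/
theorem stmt15 {n m q : ℕ}
    (f : EuclideanSpace ℝ (Fin n) → EuclideanSpace ℝ (Fin m) → ℝ)
    (g : EuclideanSpace ℝ (Fin n) → EuclideanSpace ℝ (Fin m) → Fin q → ℝ)
    (X : Set (EuclideanSpace ℝ (Fin n))) (hXc : IsClosed X)
    (hf : ContDiff ℝ 2 (fun p : EuclideanSpace ℝ (Fin n) × EuclideanSpace ℝ (Fin m) => f p.1 p.2))
    (hg : ∀ i, ContDiff ℝ 2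
      (fun p : EuclideanSpace ℝ (Fin n) × EuclideanSpace ℝ (Fin m) => g p.1 p.2 i))
    (hconv : ∀ x ∈ X, ConcaveOn ℝ Set.univ (f x) ∧ ∀ i, ConvexOn ℝ Set.univ (fun y => g x y i))
    (xb : EuclideanSpace ℝ (Fin n)) (hint : xb ∈ interior X)
    (hmin : IsLocalMinOn (Vfun f g) X xb)
    (yb : EuclideanSpace ℝ (Fin m)) (hyb : yb ∈ Sol f g xb)
    (lamb : Fin q → ℝ) (hlamb : lamb ∈ SigmaSet f g xb yb)
    (hcq : CQAt (WolfeG n m q) (WolfeH f g) (xb, yb, lamb)) :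
    ∃ u : EuclideanSpace ℝ (Fin m),
      gradxL f g xb yb lamb + hessxyLu f g xb yb lamb u = 0 ∧
      hessyyLu f g xb yb lamb u = 0 ∧
      gradyL f g xb yb lamb = 0 ∧
      (∀ i, 0 ≤ -(gyTu g xb yb u i) - g xb yb i) ∧ (∀ i, 0 ≤ lamb i) ∧
      ∑ i, lamb i * (-(gyTu g xb yb u i) - g xb yb i) = 0 ∧
      (∀ i, 0 ≤ -(g xb yb i)) ∧ ∑ i, lamb i * g xb yb i = 0 := by
  obtain ⟨hgrad, hnonneg, hfeas, hcompl⟩ := hlamb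
  have hθ := contDiff_Lag hf hg
  have hfy : Differentiable ℝ (f xb) :=
    (hf.differentiable (by norm_num)).comp (by fun_prop : Differentiable ℝ fun y => (xb, y))
  have hgy : ∀ i, Differentiable ℝ fun y => g xb y i := fun i =>
    ((hg i).differentiable (by norm_num)).comp (by fun_prop : Differentiable ℝ fun y => (xb, y))
  have hL : ∀ x lam, Differentiable ℝ fun y => Lag f g x y lam := fun x lam =>
    (hθ.differentiable (by norm_num)).comp
      (by fun_prop : Differentiable ℝ fun y : EuclideanSpace ℝ (Fin m) => (x, y, lam))
  obtain ⟨lam, mu, hlam, hkkt, hlamG⟩ := hcq _ (hθ.of_le (by norm_num))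
    (isLocalMinOn_Lag_of_isLocalMinOn_Vfun hL hconv hint hmin hyb hcompl)
  set u : EuclideanSpace ℝ (Fin m) := WithLp.toLp 2 mu with hu
  set Φ : EuclideanSpace ℝ (Fin n) × EuclideanSpace ℝ (Fin m) × (Fin q → ℝ) → ℝ :=
    fun w => ⟪gradyL f g w.1 w.2.1 w.2.2, u⟫ with hΦ
  have hH : ∀ j, Differentiable ℝ fun w => WolfeH f g w j := fun j => by
    have := hθ.differentiable_inner_gradient_snd_fst (EuclideanSpace.single j (1 : ℝ))
    convert this using 2 with w
    exact ((EuclideanSpace.inner_single_right j (1 : ℝ) (gradyL f g w.1 w.2.1 w.2.2)).trans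
      (by simp [WolfeH])).symm
  have hΦd : HasFDerivAt Φ (∑ j, mu j • fderiv ℝ (fun w => WolfeH f g w j) (xb, yb, lamb))
      (xb, yb, lamb) := by
    have hsum : Φ = fun w => ∑ j, mu j * WolfeH f g w j := by
      funext w
      simp [hΦ, hu, PiLp.inner_apply, WolfeH]
    rw [hsum]
    exact HasFDerivAt.fun_sum fun j _ => (hH j _).hasFDerivAt.const_mul (mu j)
  have hG : ∀ i, HasFDerivAt (fun w => WolfeG n m q w i)
      (-((ContinuousLinearMap.proj i).comp ((ContinuousLinearMap.snd ℝ _ _).comp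
        (ContinuousLinearMap.snd ℝ _ _)))) (xb, yb, lamb) := fun i =>
    (-((ContinuousLinearMap.proj (R := ℝ) (φ := fun _ : Fin q => ℝ) i).comp
      ((ContinuousLinearMap.snd ℝ (EuclideanSpace ℝ (Fin m)) (Fin q → ℝ)).comp
        (ContinuousLinearMap.snd ℝ (EuclideanSpace ℝ (Fin n)) _)))).hasFDerivAt
  have hθd := (hθ.differentiable (by norm_num) (xb, yb, lamb)).hasFDerivAt
  simp only [fun i => (hG i).fderiv] at hkkt
  have hat := DFunLike.congr_fun hkkt
  set Θ' := fderiv ℝ (fun w : EuclideanSpace ℝ (Fin n) × EuclideanSpace ℝ (Fin m) × (Fin q → ℝ) =>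
    Lag f g w.1 w.2.1 w.2.2) (xb, yb, lamb)
  set Φ' := ∑ j, mu j • fderiv ℝ (fun w => WolfeH f g w j) (xb, yb, lamb)
  have hΘx : HasFDerivAt (fun x => Lag f g x yb lamb) _ xb := hθd.comp_triple_left
  have hΘy : HasFDerivAt (fun y => Lag f g xb y lamb) _ yb := hθd.comp_triple_mid
  have hΦx : HasFDerivAt (fun x => ⟪gradyL f g x yb lamb, u⟫) _ xb := hΦd.comp_triple_left
  have hΦy : HasFDerivAt (fun y => ⟪gradyL f g xb y lamb, u⟫) _ yb := hΦd.comp_triple_mid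
  have hyL : ∀ v, Θ' (0, v, 0) = 0 := fun v => by
    have h := congrArg (fun z => ⟪z, v⟫) hgrad
    simp only [gradyL, grady, inner_gradient_left, inner_zero_left] at h
    rw [hΘy.fderiv] at h
    simpa using h
  have hmult : ∀ i, -(gyTu g xb yb u i) - g xb yb i = lam i := fun i => by
    have hΘl : Θ' (0, 0, Pi.single i 1) = -g xb yb i := by
      have hlin : HasFDerivAt (fun l => Lag f g xb yb l) _ lamb :=
        hasFDerivAt_const_sub_sum_mul (f xb yb) (g xb yb) lamb
      have := DFunLike.congr_fun (hθd.comp_triple_right.unique hlin) (Pi.single i 1)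
      simpa [Pi.single_apply] using this
    have hΦl : Φ' (0, 0, Pi.single i 1) = -gyTu g xb yb u i := by
      have hlin := hasFDerivAt_const_sub_sum_mul ⟪grady f xb yb, u⟫ (gyTu g xb yb u) lamb
      simp only [← inner_gradyL (hfy yb) (fun i => hgy i yb)] at hlin
      have := DFunLike.congr_fun (hΦd.comp_triple_right.unique hlin) (Pi.single i 1)
      simpa [Pi.single_apply] using this
    have h := hat (0, 0, Pi.single i 1)
    simp [hΘl, hΦl, Pi.single_apply] at h
    linarith
  refine ⟨u, ext_inner_right ℝ fun v => ?_, ext_inner_right ℝ fun v => ?_, hgrad,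
    fun i => (hmult i).symm ▸ hlam i, hnonneg, ?_, fun i => neg_nonneg.mpr (hfeas i), hcompl⟩
  · have h := hat (v, 0)
    simp only [inner_add_left, gradxL, gradx, hessxyLu, inner_gradient_left]
    rw [hΘx.fderiv, hΦx.fderiv]
    simpa using h
  · have h := hat (0, v, 0)
    simp only [hessyyLu, inner_gradient_left]
    rw [hΦy.fderiv]
    simpa [hyL] using h
  · simp only [hmult]
    simpa [WolfeG, mul_comm] using hlamG
end
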